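/- arXiv:1007.5265 — 3 statements merged into one kernel-verified Lean document; each statement's English description precedes it below -/
import Mathlib

section
/- Let V be a valuation domain with nonzero maximal ideal M and residue field F := V/M, let π : V → F be the canonical surjection, let k be a subfield of F, and let R := π⁻¹(k) be the resulting pseudo-valuation domain; assume R ≠ V. Then the following are equivalent: (i) R is stable; (ii) V is strongly discrete and dim_k F = 2; (iii) R is totally divisorial, i.e. R and every overring of R is a divisorial domain. -/
open scoped Pointwise

section Defs

variable (A K : Type*) [CommRing A] [Field K] [Algebra A K]

/-- `I` is a nonzero fractional ideal of `A` (inside `K`):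
`I ≠ 0` and `dI ⊆ A` for some nonzero `d ∈ A`. -/
def IsFrac (I : Submodule A K) : Prop :=
  I ≠ ⊥ ∧ ∃ d : A, d ≠ 0 ∧ ∀ x ∈ I, ∃ a : A, algebraMap A K d * x = algebraMap A K a

/-- The divisorial closure `I^v = (A : (A : I))`; here `(J : I) = J / I` and
`(1 : Submodule A K)` is the image of `A` in `K`. -/
def vS (I : Submodule A K) : Submodule A K := 1 / (1 / I)

/-- The `t`-operation `I^t = ⋃ {J^v : J ⊆ I nonzero finitely generated}` (a directed union,
hence equal to the supremum of submodules). -/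
def tS (I : Submodule A K) : Submodule A K :=
  ⨆ J ∈ {J : Submodule A K | J ≠ ⊥ ∧ J.FG ∧ J ≤ I}, vS A K J

/-- The image of an integral ideal of `A` in `K`. -/
def idealK (I : Ideal A) : Submodule A K := Submodule.map (Algebra.linearMap A K) I

/-- A nonzero (fractional) ideal `I` is stable if `I((I:I):I) = (I:I)`. -/
def IsStableIdeal (I : Submodule A K) : Prop := I * ((I / I) / I) = I / I

/-- `A` is a stable domain: every nonzero (fractional) ideal is stable. -/
def StableDomain : Prop := ∀ I : Submodule A K, IsFrac A K I → IsStableIdeal A K I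

/-- `A` is Clifford regular: every nonzero (fractional) ideal `I` satisfies `I = I²J`
for some nonzero `A`-submodule `J` of `K`. -/
def CliffordRegularDomain : Prop :=
  ∀ I : Submodule A K, IsFrac A K I → ∃ J : Submodule A K, J ≠ ⊥ ∧ I = I * I * J

end Defs

/-- A valuation domain: any two elements are comparable under divisibility
(equivalently, the ideals are totally ordered by inclusion). -/
def IsValuationDomain (A : Type*) [CommRing A] : Prop := ∀ x y : A, x ∣ y ∨ y ∣ x

/-- A domain is strongly discrete if `P² ≠ P` for every nonzero prime ideal `P`. -/
def StronglyDiscrete (A : Type*) [CommRing A] : Prop :=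
  ∀ P : Ideal A, P.IsPrime → P ≠ ⊥ → P * P ≠ P

/-- `A` (with quotient field contained in `K`) is a divisorial domain: every nonzero
fractional ideal `I` satisfies `I = (A : (A : I))`. -/
def DivisorialDomain (A K : Type*) [CommRing A] [Field K] [Algebra A K] : Prop :=
  ∀ I : Submodule A K, IsFrac A K I → vS A K I = I

/-- The nonunits of the valuation ring `V` all lie in the subring `R`, and an element of `R` that
is invertible in `V` is invertible in `R`. -/
structure IsPseudoValuationPair {K : Type*} [Field K] (V R : Subring K) : Prop where
  mem_or_inv_mem : ∀ x : K, x ∈ V ∨ x⁻¹ ∈ V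
  le : R ≤ V
  mem_of_inv_notMem : ∀ x ∈ V, x⁻¹ ∉ V → x ∈ R
  inv_mem : ∀ x ∈ R, x⁻¹ ∈ V → x⁻¹ ∈ R

/-- The ring `(I : I)` of multipliers of a submodule of `K`. -/
def Submodule.multiplierRing {A K : Type*} [CommRing A] [Field K] [Algebra A K]
    (I : Submodule A K) : Subring K where
  carrier := {x | ∀ y ∈ I, x * y ∈ I}
  mul_mem' {a b} ha hb y hy := by
    rw [mul_assoc]
    exact ha _ (hb _ hy)
  one_mem' y hy := by rwa [one_mul]
  add_mem' {a b} ha hb y hy := by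
    rw [add_mul]
    exact I.add_mem (ha _ hy) (hb _ hy)
  zero_mem' y hy := by
    rw [zero_mul]
    exact I.zero_mem
  neg_mem' {a} ha y hy := by
    rw [neg_mul]
    exact I.neg_mem (ha _ hy)

section Multipliers

variable {K : Type*} [Field K] {A : Subring K} {I : Submodule A K}

theorem Submodule.mem_multiplierRing {x : K} :
    x ∈ I.multiplierRing ↔ ∀ y ∈ I, x * y ∈ I := Iff.rfl

theorem Submodule.mem_div_self_iff {x : K} : x ∈ I / I ↔ x ∈ I.multiplierRing :=
  Submodule.mem_div_iff_forall_mul_mem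

theorem Submodule.le_multiplierRing : A ≤ I.multiplierRing :=
  fun x hx _ hy => I.smul_mem (⟨x, hx⟩ : A) hy

theorem Submodule.mem_one_subring_iff {x : K} : x ∈ (1 : Submodule A K) ↔ x ∈ A := by
  rw [Submodule.mem_one]
  exact ⟨fun ⟨y, hy⟩ => hy ▸ y.2, fun h => ⟨⟨x, h⟩, rfl⟩⟩

theorem Submodule.mem_one_div_iff {x : K} :
    x ∈ (1 : Submodule A K) / I ↔ ∀ y ∈ I, x * y ∈ A := by
  simp only [Submodule.mem_div_iff_forall_mul_mem, Submodule.mem_one_subring_iff]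

theorem mem_vS_iff {x : K} :
    x ∈ vS A K I ↔ ∀ z, (∀ y ∈ I, z * y ∈ A) → x * z ∈ A := by
  simp only [vS, Submodule.mem_one_div_iff]

/-- A submodule which is principal over its ring of multipliers is stable. -/
theorem isStableIdeal_of_principal {a : K} (ha : a ∈ I) (ha0 : a ≠ 0)
    (h : ∀ b ∈ I, a⁻¹ * b ∈ I.multiplierRing) : IsStableIdeal A K I := by
  apply le_antisymm
  · refine Submodule.mul_le.2 fun x hx y hy => ?_
    rw [mul_comm]
    exact Submodule.mem_div_iff_forall_mul_mem.1 hy x hx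
  · intro t ht
    rw [Submodule.mem_div_self_iff] at ht
    have key : a⁻¹ * t ∈ (I / I) / I := by
      refine Submodule.mem_div_iff_forall_mul_mem.2 fun b hb => ?_
      rw [Submodule.mem_div_self_iff, mul_right_comm]
      exact mul_mem (h b hb) ht
    have := Submodule.mul_mem_mul ha key
    rwa [mul_inv_cancel_left₀ ha0] at this

/-- A submodule `I` which is principal over `T = (I : I)` is divisorial as soon as `(A : T)` is
principal over `T`. -/
theorem vS_eq_of_principal {a p : K} (ha : a ∈ I) (ha0 : a ≠ 0)
    (h : ∀ b ∈ I, a⁻¹ * b ∈ I.multiplierRing) (hp0 : p ≠ 0)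
    (hp : ∀ x, (∀ t ∈ I.multiplierRing, x * t ∈ A) ↔ p⁻¹ * x ∈ I.multiplierRing) :
    vS A K I = I := by
  ext y
  rw [mem_vS_iff]
  constructor
  · intro hy
    have key : p⁻¹ * (y * a⁻¹ * p) ∈ I.multiplierRing := by
      refine (hp _).1 fun t ht => ?_
      rw [show y * a⁻¹ * p * t = y * (a⁻¹ * p * t) by ring]
      refine hy _ fun b hb => ?_
      have hb' : p⁻¹ * (p * (t * (a⁻¹ * b))) ∈ I.multiplierRing := by
        rw [inv_mul_cancel_left₀ hp0]
        exact mul_mem ht (h b hb)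
      have := (hp _).2 hb' 1 (one_mem _)
      rwa [mul_one, show p * (t * (a⁻¹ * b)) = a⁻¹ * p * t * b by ring] at this
    have := key a ha
    rwa [show p⁻¹ * (y * a⁻¹ * p) * a = y by field_simp] at this
  · intro hy z hz
    rw [mul_comm]
    exact hz y hy

end Multipliers

section StronglyDiscrete

variable {K : Type*} [Field K] {V : Subring K}

/-- In a strongly discrete valuation domain, the maximal ideal of every proper overring is
principal over that overring. -/
theorem StronglyDiscrete.exists_generator (hV : ∀ x : K, x ∈ V ∨ x⁻¹ ∈ V)
    (hSD : StronglyDiscrete V) {T : Subring K} (hVT : V ≤ T) (hT : ∃ x ∈ T, x⁻¹ ∉ T) :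
    ∃ p ∈ T, p⁻¹ ∉ T ∧ ∀ b ∈ T, b⁻¹ ∉ T → p⁻¹ * b ∈ T := by
  have hmemV : ∀ x : K, x⁻¹ ∉ T → x ∈ V := fun x hx =>
    (hV x).resolve_right fun h => hx (hVT h)
  let P : Ideal V :=
    { carrier := {x | (x : K) = 0 ∨ (x : K)⁻¹ ∉ T}
      zero_mem' := Or.inl rfl
      add_mem' := by
        intro x y hx hy
        by_contra hxy
        obtain ⟨h0, h1⟩ := not_or.1 hxy
        rw [not_not] at h1
        push_cast at h0 h1
        rcases eq_or_ne (x : K) 0 with hx0 | hx0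
        · rw [hx0, zero_add] at h0 h1
          exact hy.elim h0 fun h => h h1
        rcases eq_or_ne (y : K) 0 with hy0 | hy0
        · rw [hy0, add_zero] at h0 h1
          exact hx.elim h0 fun h => h h1
        rcases hV ((x : K) * (y : K)⁻¹) with h | h
        · refine hy.resolve_left hy0 ?_
          have := mul_mem h1 (add_mem (hVT h) (one_mem T))
          rwa [show ((x : K) + y)⁻¹ * (x * (y : K)⁻¹ + 1) = (y : K)⁻¹ by field_simp] at this
        · refine hx.resolve_left hx0 ?_
          have := mul_mem h1 (add_mem (one_mem T) (hVT h))
          rwa [show ((x : K) + y)⁻¹ * (1 + ((x : K) * (y : K)⁻¹)⁻¹) = (x : K)⁻¹ by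
            field_simp] at this
      smul_mem' := by
        intro c x hx
        by_contra hcx
        obtain ⟨h0, h1⟩ := not_or.1 hcx
        rw [not_not] at h1
        simp only [smul_eq_mul, Subring.coe_mul] at h0 h1
        refine (hx.resolve_left (right_ne_zero_of_mul h0)) ?_
        have := mul_mem (hVT c.2) h1
        rwa [mul_inv, mul_inv_cancel_left₀ (left_ne_zero_of_mul h0)] at this }
  have hP : ∀ x : V, x ∈ P ↔ (x : K) = 0 ∨ (x : K)⁻¹ ∉ T := fun _ => Iff.rfl
  have hprime : P.IsPrime := by
    refine ⟨fun h => ?_, fun {x y} hxy => ?_⟩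
    · have : (1 : V) ∈ P := h ▸ trivial
      rw [hP] at this
      simp [one_mem] at this
    · by_contra hcon
      obtain ⟨hx, hy⟩ := not_or.1 hcon
      rw [hP, not_or, not_not] at hx hy
      rw [hP] at hxy
      push_cast at hxy
      rcases hxy with h | h
      · exact (mul_ne_zero hx.1 hy.1) h
      · rw [mul_inv] at h
        exact h (mul_mem hx.2 hy.2)
  have hbot : P ≠ ⊥ := by
    obtain ⟨x, hx, hxT⟩ := hT
    intro h
    have hx' : (⟨x, hmemV x hxT⟩ : V) ∈ P := Or.inr hxT
    rw [h, Ideal.mem_bot, Subtype.ext_iff] at hx'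
    exact hxT (by simp_all)
  by_contra! hcon
  refine hSD P hprime hbot (le_antisymm Ideal.mul_le_left fun x hx => ?_)
  rcases hx with hx | hx
  · rw [show x = 0 from Subtype.ext hx]
    exact Submodule.zero_mem _
  · obtain ⟨b, hb, hbT, hxb⟩ := hcon x (hVT x.2) hx
    have hb0 : b ≠ 0 := by rintro rfl; simp at hbT
    have hq : ((x : K) * b⁻¹)⁻¹ ∉ T := by rwa [mul_inv, inv_inv]
    have hx' : x = ⟨(x : K) * b⁻¹, hmemV _ hq⟩ * ⟨b, hmemV _ hbT⟩ :=
      Subtype.ext (by simp [hb0])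
    rw [hx']
    exact Ideal.mul_mem_mul (Or.inr hq) (Or.inr hbT)

/-- Over a strongly discrete valuation domain every nonzero submodule of the quotient field is
principal over its ring of multipliers. -/
theorem StronglyDiscrete.exists_principal (hV : ∀ x : K, x ∈ V ∨ x⁻¹ ∈ V)
    (hSD : StronglyDiscrete V) {A : Subring K} {I : Submodule A K}
    (hVI : V ≤ I.multiplierRing) (hI : I ≠ ⊥) :
    ∃ a ∈ I, a ≠ 0 ∧ ∀ b ∈ I, a⁻¹ * b ∈ I.multiplierRing := by
  by_contra! hcon
  have hstep : ∀ a ∈ I, a ≠ 0 → ∃ b ∈ I, b ≠ 0 ∧ a * b⁻¹ ∈ I.multiplierRing ∧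
      (a * b⁻¹)⁻¹ ∉ I.multiplierRing := by
    intro a ha ha0
    obtain ⟨b, hb, hab⟩ := hcon a ha ha0
    have hinv : (a * b⁻¹)⁻¹ = a⁻¹ * b := by rw [mul_inv, inv_inv]
    refine ⟨b, hb, ?_, ?_, by rwa [hinv]⟩
    · rintro rfl
      simp [zero_mem] at hab
    · exact hVI ((hV _).resolve_right fun h => hab (hVI (hinv ▸ h)))
  obtain ⟨a, ha, ha0⟩ := I.ne_bot_iff.1 hI
  obtain ⟨b, -, -, h1, h2⟩ := hstep a ha ha0
  obtain ⟨p, hp, hpT, hgen⟩ := hSD.exists_generator hV hVI ⟨_, h1, h2⟩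
  refine hpT fun y hy => ?_
  rcases eq_or_ne y 0 with rfl | hy0
  · rw [mul_zero]
    exact I.zero_mem
  obtain ⟨c, hc, hc0, h3, h4⟩ := hstep y hy hy0
  have := hgen _ h3 h4 c hc
  rwa [show p⁻¹ * (y * c⁻¹) * c = p⁻¹ * y by field_simp] at this

/-- A multiplier of an idempotent ideal into its multiplier ring is itself a multiplier. -/
theorem Ideal.forall_mul_mem_of_mul_self_eq {P : Ideal V} (hP : P * P = P) {y : K}
    (h : ∀ a ∈ P, ∀ b ∈ P, ∃ c ∈ P, y * a * b = (c : K)) :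
    ∀ x ∈ P, ∃ c ∈ P, y * x = (c : K) := by
  intro x hx
  rw [← hP] at hx
  induction hx using Submodule.mul_induction_on' with
  | mem_mul_mem a ha b hb =>
    obtain ⟨c, hc, e⟩ := h a ha b hb
    exact ⟨c, hc, by rw [← e]; push_cast; ring⟩
  | add a _ b _ iha ihb =>
    obtain ⟨c, hc, e⟩ := iha
    obtain ⟨d, hd, e'⟩ := ihb
    exact ⟨c + d, P.add_mem hc hd, by push_cast; rw [mul_add, e, e']⟩

/-- An ideal of `V`, as a submodule of `K` over a ring all of whose elements multiply it into
itself. -/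
def Ideal.toSubmoduleOf (P : Ideal V) (D : Subring K)
    (hD : ∀ d ∈ D, ∀ x ∈ P, ∃ c ∈ P, d * x = (c : K)) : Submodule D K where
  carrier := {x | ∃ c ∈ P, x = (c : K)}
  zero_mem' := ⟨0, P.zero_mem, rfl⟩
  add_mem' := by
    rintro _ _ ⟨a, ha, rfl⟩ ⟨b, hb, rfl⟩
    exact ⟨a + b, P.add_mem ha hb, by push_cast; rfl⟩
  smul_mem' := by
    rintro d _ ⟨a, ha, rfl⟩
    exact hD d d.2 a ha

variable {P : Ideal V} {D : Subring K}
  {hD : ∀ d ∈ D, ∀ x ∈ P, ∃ c ∈ P, d * x = (c : K)}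

theorem Ideal.mem_toSubmoduleOf {x : K} :
    x ∈ P.toSubmoduleOf D hD ↔ ∃ c ∈ P, x = (c : K) := Iff.rfl

theorem Ideal.toSubmoduleOf_ne_bot (hP : P ≠ ⊥) : P.toSubmoduleOf D hD ≠ ⊥ := by
  obtain ⟨x, hx, hx0⟩ := P.ne_bot_iff.1 hP
  exact (Submodule.ne_bot_iff _).2 ⟨x, ⟨x, hx, rfl⟩, by simpa using hx0⟩

theorem Ideal.one_notMem_toSubmoduleOf (hP : P.IsPrime) : (1 : K) ∉ P.toSubmoduleOf D hD := by
  rintro ⟨c, hc, e⟩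
  exact P.one_notMem (by rwa [show (1 : V) = c from Subtype.ext e])

theorem Ideal.mem_multiplierRing_of_mul_self_eq (hP : P * P = P) {y : K}
    (hy : ∀ a ∈ P.toSubmoduleOf D hD, y * a ∈ (P.toSubmoduleOf D hD).multiplierRing) :
    y ∈ (P.toSubmoduleOf D hD).multiplierRing := by
  rintro _ ⟨x, hx, rfl⟩
  exact Ideal.forall_mul_mem_of_mul_self_eq hP
    (fun a ha b hb => hy a ⟨a, ha, rfl⟩ b ⟨b, hb, rfl⟩) x hx

end StronglyDiscrete

namespace IsPseudoValuationPair

variable {K : Type*} [Field K] {V R : Subring K}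

theorem mul_mem_of_nonunit (h : IsPseudoValuationPair V R) {s x : K} (hs : s ∈ V)
    (hs' : s ≠ 0 → s⁻¹ ∉ V) (hx : x ∈ V) : s * x ∈ R := by
  rcases eq_or_ne s 0 with rfl | hs0
  · rw [zero_mul]
    exact zero_mem R
  rcases eq_or_ne x 0 with rfl | hx0
  · rw [mul_zero]
    exact zero_mem R
  refine h.mem_of_inv_notMem _ (V.mul_mem hs hx) fun hsx => hs' hs0 ?_
  have := V.mul_mem hx hsx
  rwa [show x * (s * x)⁻¹ = s⁻¹ by field_simp] at this

theorem add_nonunit (h : IsPseudoValuationPair V R) {x y : K} (hx : x ≠ 0 → x⁻¹ ∉ V)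
    (hy : y ≠ 0 → y⁻¹ ∉ V) : x + y ≠ 0 → (x + y)⁻¹ ∉ V := by
  intro h0 h1
  rcases eq_or_ne x 0 with rfl | hx0
  · rw [zero_add] at h0 h1
    exact hy h0 h1
  rcases eq_or_ne y 0 with rfl | hy0
  · rw [add_zero] at h0 h1
    exact hx h0 h1
  rcases h.mem_or_inv_mem (x * y⁻¹) with h2 | h2
  · refine hy hy0 ?_
    have := V.mul_mem h1 (add_mem h2 (one_mem V))
    rwa [show (x + y)⁻¹ * (x * y⁻¹ + 1) = y⁻¹ by field_simp] at this
  · refine hx hx0 ?_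
    have := V.mul_mem h1 (add_mem (one_mem V) h2)
    rwa [show (x + y)⁻¹ * (1 + (x * y⁻¹)⁻¹) = x⁻¹ by field_simp] at this

theorem smul_mem_ideal (h : IsPseudoValuationPair V R) (P : Ideal V) :
    ∀ d ∈ R, ∀ x ∈ P, ∃ c ∈ P, d * x = (c : K) :=
  fun d hd x hx => ⟨⟨d, h.le hd⟩ * x, P.mul_mem_left _ hx, rfl⟩

/-- When `V = R + Rx` for all `x ∈ V \ R`, a module over an overring of `R` is a `V`-module
or is of the form `aR`. -/
theorem le_multiplierRing_or_principal (h : IsPseudoValuationPair V R)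
    (hdim : ∀ x ∈ V, x ∉ R → ∀ y ∈ V, ∃ a ∈ R, ∃ b ∈ R, y = a + b * x)
    {A : Subring K} (hA : R ≤ A) (I : Submodule A K) :
    V ≤ I.multiplierRing ∨ ∃ a ∈ I, a ≠ 0 ∧ ∀ b ∈ I, a⁻¹ * b ∈ R := by
  by_contra! hcon
  obtain ⟨h1, h2⟩ := hcon
  refine h1 fun v hv a ha => ?_
  have hsmul : ∀ r ∈ R, ∀ x ∈ I, r * x ∈ I := fun r hr x hx =>
    I.smul_mem (⟨r, hA hr⟩ : A) hx
  rcases eq_or_ne a 0 with rfl | ha0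
  · rw [mul_zero]
    exact I.zero_mem
  obtain ⟨b, hb, hab⟩ := h2 a ha ha0
  by_cases hV : a⁻¹ * b ∈ V
  · obtain ⟨r, hr, s, hs, rfl⟩ := hdim _ hV hab v hv
    rw [show (r + s * (a⁻¹ * b)) * a = r * a + s * b by field_simp]
    exact I.add_mem (hsmul r hr a ha) (hsmul s hs b hb)
  · have hb0 : b ≠ 0 := by
      rintro rfl
      simp [zero_mem] at hV
    have hinv : (a⁻¹ * b)⁻¹ ∈ V := (h.mem_or_inv_mem _).resolve_left hV
    have := hsmul _ (h.mul_mem_of_nonunit hinv (by simpa only [inv_inv] using fun _ => hV) hv) b hb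
    rwa [show (a⁻¹ * b)⁻¹ * v * b = v * a by field_simp] at this

theorem exists_principal (h : IsPseudoValuationPair V R) (hSD : StronglyDiscrete V)
    (hdim : ∀ x ∈ V, x ∉ R → ∀ y ∈ V, ∃ a ∈ R, ∃ b ∈ R, y = a + b * x)
    {A : Subring K} (hA : R ≤ A) {I : Submodule A K} (hI : I ≠ ⊥) :
    ∃ a ∈ I, a ≠ 0 ∧ (∀ b ∈ I, a⁻¹ * b ∈ I.multiplierRing) ∧
      (V ≤ I.multiplierRing ∨ I.multiplierRing ≤ A) := by
  rcases h.le_multiplierRing_or_principal hdim hA I with hV | ⟨a, ha, ha0, hb⟩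
  · obtain ⟨a, ha, ha0, hb⟩ := hSD.exists_principal h.mem_or_inv_mem hV hI
    exact ⟨a, ha, ha0, hb, Or.inl hV⟩
  · refine ⟨a, ha, ha0, fun b hbI => Submodule.le_multiplierRing (hA (hb b hbI)),
      Or.inr fun t ht => hA ?_⟩
    have := hb _ (ht a ha)
    rwa [show a⁻¹ * (t * a) = t by field_simp] at this

theorem stableDomain (h : IsPseudoValuationPair V R) (hSD : StronglyDiscrete V)
    (hdim : ∀ x ∈ V, x ∉ R → ∀ y ∈ V, ∃ a ∈ R, ∃ b ∈ R, y = a + b * x) : StableDomain R K := by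
  intro I hI
  obtain ⟨a, ha, ha0, hb, -⟩ := h.exists_principal hSD hdim le_rfl hI.1
  exact isStableIdeal_of_principal ha ha0 hb

theorem divisorialDomain (h : IsPseudoValuationPair V R) (hSD : StronglyDiscrete V)
    (hdim : ∀ x ∈ V, x ∉ R → ∀ y ∈ V, ∃ a ∈ R, ∃ b ∈ R, y = a + b * x)
    {A : Subring K} (hA : R ≤ A) : DivisorialDomain A K := by
  intro I hI
  obtain ⟨a, ha, ha0, hb, hT⟩ := h.exists_principal hSD hdim hA hI.1
  by_cases hTA : I.multiplierRing ≤ A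
  · refine vS_eq_of_principal ha ha0 hb one_ne_zero fun x => ?_
    rw [inv_one, one_mul]
    refine ⟨fun hx => Submodule.le_multiplierRing ?_, fun hx t ht => hTA (mul_mem hx ht)⟩
    simpa using hx 1 (one_mem _)
  · have hVT := hT.resolve_right hTA
    obtain ⟨t, ht, htA⟩ := Set.not_subset.1 hTA
    have hnonunit : ∃ x ∈ I.multiplierRing, x⁻¹ ∉ I.multiplierRing := by
      by_contra! hcon
      obtain ⟨d, hd0, hd⟩ := hI.2
      have hd0' : (d : K) ≠ 0 := by simpa using hd0
      have hall : t * (d : K)⁻¹ * a⁻¹ ∈ I.multiplierRing := by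
        rcases h.mem_or_inv_mem (t * (d : K)⁻¹ * a⁻¹) with h1 | h1
        · exact hVT h1
        · simpa using hcon _ (hVT h1)
      obtain ⟨c, hc⟩ := hd _ (hall a ha)
      refine htA ?_
      have hc' : (d : K) * (t * (d : K)⁻¹ * a⁻¹ * a) = (c : K) := hc
      rw [show (d : K) * (t * (d : K)⁻¹ * a⁻¹ * a) = t by field_simp] at hc'
      exact hc' ▸ c.2
    obtain ⟨p, hp, hpT, hgen⟩ := hSD.exists_generator h.mem_or_inv_mem hVT hnonunit
    have hp0 : p ≠ 0 := by
      rintro rfl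
      simp [zero_mem] at hpT
    refine vS_eq_of_principal ha ha0 hb hp0 fun x => ⟨fun hx => ?_, fun hx s hs => ?_⟩
    · rcases eq_or_ne x 0 with rfl | hx0
      · rw [mul_zero]
        exact zero_mem _
      have hxT : x⁻¹ ∉ I.multiplierRing := by
        intro hxi
        have := hx _ (mul_mem hxi ht)
        rw [mul_inv_cancel_left₀ hx0] at this
        exact htA this
      refine hgen x ?_ hxT
      exact hVT ((h.mem_or_inv_mem x).resolve_right fun h1 => hxT (hVT h1))
    · have hs' : p⁻¹ * x * s ∈ I.multiplierRing := mul_mem hx hs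
      rcases eq_or_ne (x * s) 0 with h0 | h0
      · rw [h0]
        exact zero_mem A
      have hinv : (x * s)⁻¹ ∉ I.multiplierRing := by
        intro hxs
        have := mul_mem hs' hxs
        rw [show p⁻¹ * x * s * (x * s)⁻¹ = p⁻¹ * ((x * s) * (x * s)⁻¹) by ring,
          mul_inv_cancel₀ h0, mul_one] at this
        exact hpT this
      have hinv' : (x * s)⁻¹ ∉ V := fun h1 => hinv (hVT h1)
      exact hA (h.mem_of_inv_notMem _ ((h.mem_or_inv_mem _).resolve_right hinv') hinv')

/-- A submodule between `R` and `V` is a fractional ideal. -/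
theorem isFrac (h : IsPseudoValuationPair V R) (hm : ∃ m ∈ V, m⁻¹ ∉ V) {I : Submodule R K}
    (h1 : 1 ∈ I) (hI : ∀ x ∈ I, x ∈ V) : IsFrac R K I := by
  obtain ⟨m, hmV, hm⟩ := hm
  refine ⟨(Submodule.ne_bot_iff _).2 ⟨1, h1, one_ne_zero⟩,
    ⟨m, h.mem_of_inv_notMem m hmV hm⟩, ?_, fun x hx =>
      ⟨⟨m * x, h.mul_mem_of_nonunit hmV (fun _ => hm) (hI x hx)⟩, rfl⟩⟩
  intro h0
  have h0' : m = 0 := congrArg Subtype.val h0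
  simp [h0', zero_mem] at hm

theorem mem_span_one_pair {x y : K} :
    y ∈ Submodule.span R {1, x} ↔ ∃ a ∈ R, ∃ b ∈ R, y = a + b * x := by
  rw [Submodule.mem_span_pair]
  constructor
  · rintro ⟨a, b, rfl⟩
    exact ⟨a, a.2, b, b.2, by simp [Subring.smul_def]⟩
  · rintro ⟨a, ha, b, hb, rfl⟩
    exact ⟨⟨a, ha⟩, ⟨b, hb⟩, by simp [Subring.smul_def]⟩

theorem span_le_of_subset (h : IsPseudoValuationPair V R) {s : Set K} (hs : s ⊆ V) :
    ∀ x ∈ Submodule.span R s, x ∈ V := by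
  intro x hx
  induction hx using Submodule.span_induction with
  | mem x hx => exact hs hx
  | zero => exact zero_mem V
  | add x y _ _ hx hy => exact add_mem hx hy
  | smul a x _ hx => exact V.mul_mem (h.le a.2) hx

theorem exists_unit_of_stable (h : IsPseudoValuationPair V R)
    (hm : ∃ m ∈ V, m⁻¹ ∉ V) (hst : StableDomain R K)
    {I : Submodule R K} (h1 : 1 ∈ I) (hI : ∀ x ∈ I, x ∈ V) :
    ∃ b ∈ I.multiplierRing, b ≠ 0 ∧ b⁻¹ ∈ V ∧ ∀ c ∈ I, b * c ∈ I.multiplierRing := by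
  have hone : (1 : K) ∈ I * ((I / I) / I) := by
    rw [show I * ((I / I) / I) = I / I from hst I (h.isFrac hm h1 hI),
      Submodule.mem_div_self_iff]
    exact one_mem _
  have hTI : ∀ t ∈ I.multiplierRing, t ∈ I := fun t ht => by simpa using ht 1 h1
  by_contra! hcon
  suffices ∀ z ∈ I * ((I / I) / I), z ≠ 0 → z⁻¹ ∉ V from
    this 1 hone one_ne_zero (by simp [one_mem])
  intro z hz
  induction hz using Submodule.mul_induction_on' with
  | mem_mul_mem a ha b hb =>
    have hb' : ∀ c ∈ I, b * c ∈ I.multiplierRing := fun c hc =>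
      Submodule.mem_div_self_iff.1 (Submodule.mem_div_iff_forall_mul_mem.1 hb c hc)
    intro h0 hab
    obtain ⟨ha0, hb0⟩ := mul_ne_zero_iff.1 h0
    have hbT : b ∈ I.multiplierRing := by simpa using hb' 1 h1
    have hbV : b⁻¹ ∈ V := by
      have := V.mul_mem (hI a ha) hab
      rwa [show a * (a * b)⁻¹ = b⁻¹ by field_simp] at this
    obtain ⟨c, hc, hbc⟩ := hcon b hbT hb0 hbV
    exact hbc (hb' c hc)
  | add x _ y _ hx hy => exact h.add_nonunit hx hy

theorem mul_self_mem_of_stable (h : IsPseudoValuationPair V R)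
    (hm : ∃ m ∈ V, m⁻¹ ∉ V) (hst : StableDomain R K)
    {x : K} (hx : x ∈ V) (hxR : x ∉ R) :
    ∃ p ∈ R, ∃ q ∈ R, x * x = p + q * x := by
  rw [← mem_span_one_pair]
  set I := Submodule.span R {1, x}
  have h1 : (1 : K) ∈ I := Submodule.subset_span (by simp)
  have hxI : x ∈ I := Submodule.subset_span (by simp)
  by_contra hcon
  have hTR : I.multiplierRing ≤ R := by
    intro t ht
    have htI : t ∈ I := by simpa using ht 1 h1
    obtain ⟨r, hr, s, hs, e⟩ := mem_span_one_pair.1 htI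
    by_cases hsu : s ≠ 0 ∧ s⁻¹ ∈ V
    · have hsR := h.inv_mem s hs hsu.2
      have hxT : s⁻¹ * (t - r) ∈ I.multiplierRing :=
        mul_mem (Submodule.le_multiplierRing hsR)
          (sub_mem ht (Submodule.le_multiplierRing hr))
      rw [e, add_sub_cancel_left, inv_mul_cancel_left₀ hsu.1] at hxT
      exact absurd (hxT x hxI) hcon
    · rw [e]
      exact add_mem hr (h.mul_mem_of_nonunit (h.le hs) (fun h0 h2 => hsu ⟨h0, h2⟩) hx)
  have hIV : ∀ y ∈ I, y ∈ V :=
    h.span_le_of_subset (by rintro y (rfl | rfl); exacts [one_mem V, hx])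
  obtain ⟨b, hb, hb0, hbV, hbI⟩ := h.exists_unit_of_stable hm hst h1 hIV
  have := R.mul_mem (h.inv_mem b (hTR hb) hbV) (hTR (hbI x hxI))
  rw [inv_mul_cancel_left₀ hb0] at this
  exact hxR this

theorem inv_mem_span_of_stable (h : IsPseudoValuationPair V R)
    (hm : ∃ m ∈ V, m⁻¹ ∉ V) (hst : StableDomain R K)
    {u : K} (hu : u ∈ V) (hu0 : u ≠ 0) (hu' : u⁻¹ ∈ V) :
    ∃ r ∈ R, ∃ s ∈ R, u⁻¹ = r + s * u := by
  by_cases huR : u ∈ R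
  · exact ⟨u⁻¹, h.inv_mem u huR hu', 0, zero_mem R, by ring⟩
  obtain ⟨p, hp, q, hq, e⟩ := h.mul_self_mem_of_stable hm hst hu huR
  have hqR : u - q ∉ R := fun h1 => huR (by simpa using add_mem h1 hq)
  have hq0 : u - q ≠ 0 := fun h1 => hqR (h1 ▸ zero_mem R)
  have hqV : (u - q)⁻¹ ∈ V := by
    by_contra hcon
    exact hqR (h.mem_of_inv_notMem _ (sub_mem hu (h.le hq)) hcon)
  have ep : p = u * (u - q) := by linear_combination -e
  have hpR : p⁻¹ ∈ R := h.inv_mem p hp (by rw [ep, mul_inv]; exact V.mul_mem hu' hqV)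
  refine ⟨-(p⁻¹ * q), neg_mem (R.mul_mem hpR hq), p⁻¹, hpR, ?_⟩
  rw [ep]
  field_simp
  ring

theorem le_multiplierRing_of_stable (h : IsPseudoValuationPair V R)
    (hm : ∃ m ∈ V, m⁻¹ ∉ V) (hst : StableDomain R K)
    {I : Submodule R K} (h1 : 1 ∈ I) (hI : ∀ x ∈ I, x ∈ V) :
    ∀ c ∈ I, c ∈ I.multiplierRing := by
  intro c hc
  obtain ⟨b, hb, hb0, hbV, hbI⟩ := h.exists_unit_of_stable hm hst h1 hI
  have hbI' : b ∈ I := by simpa using hb 1 h1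
  obtain ⟨r, hr, s, hs, e⟩ := h.inv_mem_span_of_stable hm hst (hI b hbI') hb0 hbV
  have hinv : b⁻¹ ∈ I.multiplierRing := by
    rw [e]
    exact add_mem (Submodule.le_multiplierRing hr)
      (mul_mem (Submodule.le_multiplierRing hs) hb)
  have := mul_mem hinv (hbI c hc)
  rwa [inv_mul_cancel_left₀ hb0] at this

theorem eq_add_mul_of_stable (h : IsPseudoValuationPair V R)
    (hm : ∃ m ∈ V, m⁻¹ ∉ V) (hst : StableDomain R K) :
    ∀ x ∈ V, x ∉ R → ∀ y ∈ V, ∃ a ∈ R, ∃ b ∈ R, y = a + b * x := by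
  intro x hx hxR y hy
  set I := Submodule.span R {1, x, y} with hIdef
  have h1 : (1 : K) ∈ I := Submodule.subset_span (by simp)
  have hxI : x ∈ I := Submodule.subset_span (by simp)
  have hyI : y ∈ I := Submodule.subset_span (by simp)
  have hIV : ∀ y ∈ I, y ∈ V :=
    h.span_le_of_subset (by rintro z (rfl | rfl | rfl); exacts [one_mem V, hx, hy])
  have hxy := h.le_multiplierRing_of_stable hm hst h1 hIV x hxI y hyI
  rw [hIdef, Submodule.mem_span_triple] at hxy
  obtain ⟨⟨a, ha⟩, ⟨b, hb⟩, ⟨c, hc⟩, e⟩ := hxy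
  simp only [Subring.smul_def, smul_eq_mul, mul_one] at e
  have hzR : x - c ∉ R := fun h2 => hxR (by simpa using add_mem h2 hc)
  have hz0 : x - c ≠ 0 := fun h2 => hzR (h2 ▸ zero_mem R)
  have hzV : x - c ∈ V := sub_mem hx (h.le hc)
  have hzV' : (x - c)⁻¹ ∈ V := by
    by_contra hcon
    exact hzR (h.mem_of_inv_notMem _ hzV hcon)
  obtain ⟨r, hr, s, hs, e'⟩ := h.inv_mem_span_of_stable hm hst hzV hz0 hzV'
  obtain ⟨p, hp, q, hq, e''⟩ := h.mul_self_mem_of_stable hm hst hx hxR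
  have hy' : y = (x - c)⁻¹ * (a + b * x) := by
    rw [eq_inv_mul_iff_mul_eq₀ hz0]
    linear_combination -e
  have hr' : r - s * c ∈ R := sub_mem hr (R.mul_mem hs hc)
  refine ⟨(r - s * c) * a + s * b * p,
    add_mem (R.mul_mem hr' ha) (R.mul_mem (R.mul_mem hs hb) hp),
    (r - s * c) * b + s * a + s * b * q,
    add_mem (add_mem (R.mul_mem hr' hb) (R.mul_mem hs ha)) (R.mul_mem (R.mul_mem hs hb) hq), ?_⟩
  rw [hy', e']
  linear_combination s * b * e''

theorem stronglyDiscrete_of_stable (h : IsPseudoValuationPair V R)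
    (hm : ∃ m ∈ V, m⁻¹ ∉ V) (hst : StableDomain R K) : StronglyDiscrete V := by
  intro P hP hP0 hPP
  let I : Submodule R K := P.toSubmoduleOf R (h.smul_mem_ideal P)
  obtain ⟨m, hmV, hm⟩ := hm
  have hmR : m ∈ R := h.mem_of_inv_notMem m hmV hm
  have hfrac : IsFrac R K I := by
    refine ⟨Ideal.toSubmoduleOf_ne_bot hP0, ⟨m, hmR⟩, ?_, ?_⟩
    · intro h0
      have h0' : m = 0 := congrArg Subtype.val h0
      simp [h0', zero_mem] at hm
    · rintro _ ⟨c, -, rfl⟩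
      exact ⟨⟨m * c, h.mul_mem_of_nonunit hmV (fun _ => hm) c.2⟩, rfl⟩
  have hone : (1 : K) ∈ I * ((I / I) / I) := by
    rw [show I * ((I / I) / I) = I / I from hst I hfrac, Submodule.mem_div_self_iff]
    exact one_mem _
  refine Ideal.one_notMem_toSubmoduleOf (hD := h.smul_mem_ideal P) hP
    (Submodule.mul_le.2 (fun a ha y hy => ?_) hone)
  rw [mul_comm]
  refine Ideal.mem_multiplierRing_of_mul_self_eq hPP (fun b hb => ?_) a ha
  exact Submodule.mem_div_self_iff.1 (Submodule.mem_div_iff_forall_mul_mem.1 hy b hb)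

theorem eq_add_mul_of_divisorial (h : IsPseudoValuationPair V R)
    (hm : ∃ m ∈ V, m⁻¹ ∉ V) (hdiv : DivisorialDomain R K) :
    ∀ x ∈ V, x ∉ R → ∀ y ∈ V, ∃ a ∈ R, ∃ b ∈ R, y = a + b * x := by
  intro x hx hxR y hy
  have h1 : (1 : K) ∈ Submodule.span R {1, x} := Submodule.subset_span (by simp)
  have hxI : x ∈ Submodule.span R {1, x} := Submodule.subset_span (by simp)
  have hIV : ∀ y ∈ Submodule.span R {1, x}, y ∈ V :=
    h.span_le_of_subset (by rintro z (rfl | rfl); exacts [one_mem V, hx])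
  rw [← mem_span_one_pair, ← hdiv _ (h.isFrac hm h1 hIV), mem_vS_iff]
  intro z hz
  have hzR : z ∈ R := by simpa using hz 1 h1
  rw [mul_comm]
  refine h.mul_mem_of_nonunit (h.le hzR) (fun hz0 hzV => hxR ?_) hy
  have := R.mul_mem (h.inv_mem z hzR hzV) (hz x hxI)
  rwa [inv_mul_cancel_left₀ hz0] at this

theorem stronglyDiscrete_of_divisorial (h : IsPseudoValuationPair V R)
    (hdiv : ∀ D : Subring K, R ≤ D → DivisorialDomain D K) :
    StronglyDiscrete V := by
  intro P hP hP0 hPP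
  let T := (P.toSubmoduleOf R (h.smul_mem_ideal P)).multiplierRing
  have hT : ∀ d ∈ T, ∀ x ∈ P, ∃ c ∈ P, d * x = (c : K) := fun d hd x hx => hd x ⟨x, hx, rfl⟩
  have hPT : ∀ x ∈ P, (x : K) ∈ T := by
    rintro x hx _ ⟨y, hy, rfl⟩
    exact ⟨x * y, P.mul_mem_left _ hy, rfl⟩
  have hfrac : IsFrac T K (P.toSubmoduleOf T hT) := by
    refine ⟨Ideal.toSubmoduleOf_ne_bot hP0, 1, one_ne_zero, ?_⟩
    rintro _ ⟨c, hc, rfl⟩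
    exact ⟨⟨c, hPT c hc⟩, by simp; rfl⟩
  refine Ideal.one_notMem_toSubmoduleOf (hD := hT) hP ?_
  rw [← hdiv T Submodule.le_multiplierRing _ hfrac, mem_vS_iff]
  intro z hz
  rw [one_mul]
  refine Ideal.mem_multiplierRing_of_mul_self_eq hPP fun b hb => ?_
  exact hz b hb

end IsPseudoValuationPair

/-- A vector space containing two independent vectors `e`, `x` has dimension `2` iff they span. -/
theorem rank_eq_two_iff_of_pair {k F : Type*} [Field k] [AddCommGroup F] [Module k F] {e x : F}
    (he : e ≠ 0) (hx : ∀ a : k, a • e ≠ x) :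
    Module.rank k F = 2 ↔ ∀ y, ∃ a b : k, a • e + b • x = y := by
  have hli : LinearIndependent k ![e, x] := (LinearIndependent.pair_iff' he).2 hx
  have hspan : (∀ y, ∃ a b : k, a • e + b • x = y) ↔ ⊤ ≤ Submodule.span k (Set.range ![e, x]) := by
    simp [SetLike.le_def, Submodule.mem_span_pair, Set.pair_comm x e]
  rw [hspan]
  constructor
  · intro hr
    have hfr : Module.finrank k F = 2 := Module.finrank_eq_of_rank_eq (by simpa using hr)
    exact (hli.span_eq_top_of_card_eq_finrank (by simp [hfr])).ge
  · intro hs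
    simpa using rank_eq_card_basis (Module.Basis.mk hli hs)

set_option synthInstance.maxHeartbeats 1000000 in
/-- Let `V ⊆ K` be a valuation domain with quotient field `K`, nonzero
maximal ideal `M` and residue field `F = V/M`, let `π : V → F` be the canonical surjection,
`k` a subfield of `F` (a subring in which every nonzero element is invertible), and
`R := π⁻¹(k)` the resulting pseudo-valuation domain, with `R ≠ V`. The following are
equivalent: (i) `R` is stable; (ii) `V` is strongly discrete and `dim_k F = 2`;
(iii) `R` is totally divisorial (`R` and every overring of `R` is a divisorial domain). -/
theorem pseudo_valuation_stable_iff
    {K : Type*} [Field K] (V : Subring K)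
    (hQF : ∀ x : K, ∃ a b : V, (b : K) ≠ 0 ∧ x = (a : K) / (b : K))
    (hval : IsValuationDomain V)
    (M : Ideal V) (hM : M.IsMaximal) (hM0 : M ≠ ⊥)
    (hlocal : ∀ N : Ideal V, N.IsMaximal → N = M)
    (k : Subring (V ⧸ M))
    (hk : ∀ x ∈ k, x ≠ 0 → ∃ y ∈ k, x * y = 1)
    (R : Subring K)
    (hR : R = Subring.map V.subtype (Subring.comap (Ideal.Quotient.mk M) k))
    (hRV : R ≠ V) :
    (StableDomain R K ↔ (StronglyDiscrete V ∧ Module.rank k (V ⧸ M) = 2)) ∧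
      (StableDomain R K ↔
        ∀ D : Subring K, R ≤ D → DivisorialDomain D K) := by
  have hunit : ∀ x : V, (x : K)⁻¹ ∈ V → (x : K) ≠ 0 → x ∉ M := fun x hx hx0 hxM =>
    hM.ne_top ((Ideal.eq_top_iff_one M).2 (by
      have := M.mul_mem_left ⟨_, hx⟩ hxM
      rwa [show (⟨_, hx⟩ * x : V) = 1 from Subtype.ext (inv_mul_cancel₀ hx0)] at this))
  have hnonunit : ∀ x : V, (x : K)⁻¹ ∉ V → x ∈ M := by
    intro x hx
    obtain ⟨N, hN, hxN⟩ := exists_max_ideal_of_mem_nonunits (a := x) (fun hu => hx (by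
      obtain ⟨y, hy⟩ := hu.exists_right_inv
      rw [inv_eq_of_mul_eq_one_right (congrArg Subtype.val hy : (x : K) * y = 1)]
      exact y.2))
    exact hlocal N hN ▸ hxN
  have hmemR : ∀ x : V, (x : K) ∈ R ↔ Ideal.Quotient.mk M x ∈ k := by
    intro x
    rw [hR]
    constructor
    · rintro ⟨y, hy, e⟩
      rwa [← show y = x from Subtype.ext e]
    · exact fun hx => ⟨x, hx, rfl⟩
  have h : IsPseudoValuationPair V R := by
    have hle : R ≤ V := by
      rw [hR]
      rintro _ ⟨y, -, rfl⟩
      exact y.2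
    refine ⟨fun x => ?_, hle, fun x hx hx' => ?_, fun x hx hx' => ?_⟩
    · obtain ⟨a, b, hb, rfl⟩ := hQF x
      rcases hval a b with ⟨c, rfl⟩ | ⟨c, rfl⟩
      · right
        push_cast at hb ⊢
        rw [inv_div, mul_div_cancel_left₀ _ (left_ne_zero_of_mul hb)]
        exact c.2
      · left
        push_cast
        rw [mul_div_cancel_left₀ _ hb]
        exact c.2
    · refine (hmemR ⟨x, hx⟩).2 ?_
      rw [Ideal.Quotient.eq_zero_iff_mem.2 (hnonunit ⟨x, hx⟩ hx')]
      exact zero_mem k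
    · rcases eq_or_ne x 0 with rfl | hx0
      · rwa [inv_zero]
      have hx1 := (hmemR ⟨x, hle hx⟩).1 hx
      obtain ⟨y, hy, hxy⟩ := hk _ hx1 fun h0 =>
        hunit ⟨x, hle hx⟩ hx' hx0 (Ideal.Quotient.eq_zero_iff_mem.1 h0)
      refine (hmemR ⟨x⁻¹, hx'⟩).2 ?_
      have hinv : Ideal.Quotient.mk M ⟨x⁻¹, hx'⟩ * Ideal.Quotient.mk M ⟨x, hle hx⟩ = 1 := by
        rw [← map_mul, ← map_one (Ideal.Quotient.mk M)]
        exact congrArg _ (Subtype.ext (inv_mul_cancel₀ hx0))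
      rwa [left_inv_eq_right_inv hinv hxy]
  have hm : ∃ m ∈ V, m⁻¹ ∉ V := by
    obtain ⟨m, hmM, hm0⟩ := M.ne_bot_iff.1 hM0
    exact ⟨m, m.2, fun hm => hunit m hm (by simpa using hm0) hmM⟩
  have hrank : Module.rank k (V ⧸ M) = 2 ↔
      ∀ x ∈ V, x ∉ R → ∀ y ∈ V, ∃ a ∈ R, ∃ b ∈ R, y = a + b * x := by
    have : Nontrivial (V ⧸ M) := Ideal.Quotient.nontrivial_iff.2 hM.ne_top
    have hfield : IsField k :=
      { exists_pair_ne := ⟨0, 1, zero_ne_one⟩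
        mul_comm := mul_comm
        mul_inv_cancel := fun {a} ha => by
          obtain ⟨y, hy, e⟩ := hk a a.2 (by simpa using ha)
          exact ⟨⟨y, hy⟩, Subtype.ext e⟩ }
    have hpair : ∀ x : V, (x : K) ∉ R → (Module.rank k (V ⧸ M) = 2 ↔
        ∀ y : V ⧸ M, ∃ a b : k, a • (1 : V ⧸ M) + b • Ideal.Quotient.mk M x = y) := by
      intro x hx
      let : Field k := hfield.toField
      refine rank_eq_two_iff_of_pair one_ne_zero fun a ha => hx ((hmemR x).2 ?_)
      rw [← ha, Subring.smul_def, smul_eq_mul, mul_one]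
      exact a.2
    have hlift : ∀ a : k, ∃ r : V, (r : K) ∈ R ∧ Ideal.Quotient.mk M r = a := by
      intro a
      obtain ⟨r, hr⟩ := Ideal.Quotient.mk_surjective (a : V ⧸ M)
      exact ⟨r, (hmemR r).2 (hr ▸ a.2), hr⟩
    constructor
    · intro hr x hx hxR y hy
      obtain ⟨a, b, e⟩ := (hpair ⟨x, hx⟩ hxR).1 hr (Ideal.Quotient.mk M ⟨y, hy⟩)
      obtain ⟨r, hr, hra⟩ := hlift a
      obtain ⟨s, hs, hsb⟩ := hlift b
      rw [Subring.smul_def, Subring.smul_def, smul_eq_mul, smul_eq_mul, mul_one, ← hra, ← hsb,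
        ← map_mul, ← map_add] at e
      have hd : Ideal.Quotient.mk M (⟨y, hy⟩ - (r + s * ⟨x, hx⟩)) = 0 := by
        rw [map_sub, e, sub_self]
      have hdR : y - (r + s * x) ∈ R := (hmemR _).2 (hd ▸ zero_mem k)
      exact ⟨r + (y - (r + s * x)), add_mem hr hdR, s, hs, by ring⟩
    · intro hdim
      obtain ⟨x, hx, hxR⟩ := Set.not_subset.1 fun hVR => hRV (le_antisymm h.le hVR)
      refine (hpair ⟨x, hx⟩ hxR).2 fun y => ?_
      obtain ⟨y, rfl⟩ := Ideal.Quotient.mk_surjective y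
      obtain ⟨a, ha, b, hb, e⟩ := hdim x hx hxR y y.2
      refine ⟨⟨_, (hmemR ⟨a, h.le ha⟩).1 ha⟩, ⟨_, (hmemR ⟨b, h.le hb⟩).1 hb⟩, ?_⟩
      rw [Subring.smul_def, Subring.smul_def, smul_eq_mul, smul_eq_mul, mul_one,
        ← map_mul, ← map_add]
      exact congrArg _ (Subtype.ext e.symm)
  rw [hrank]
  exact ⟨⟨fun hst => ⟨h.stronglyDiscrete_of_stable hm hst, h.eq_add_mul_of_stable hm hst⟩,
      fun hd => h.stableDomain hd.1 hd.2⟩,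
    ⟨fun hst D hD => h.divisorialDomain (h.stronglyDiscrete_of_stable hm hst)
        (h.eq_add_mul_of_stable hm hst) hD,
      fun hdiv => h.stableDomain (h.stronglyDiscrete_of_divisorial hdiv)
        (h.eq_add_mul_of_divisorial hm (hdiv R le_rfl))⟩⟩
end

section
/- Let R be an integral domain and * a semistar operation on R with R^* = R that is of finite type and satisfies (F ∩ G)^* = F^* ∩ G^* for all nonzero R-submodules F, G of K (i.e. * is spectral and of finite type). Assume R is Clifford *-regular. Let D := {x ∈ K : xJ^* ⊆ J^* for some nonzero finitely generated ideal J of R} be the *-integral closure of R. Then D is a subring of K containing R, D^* = D, and D is a Prüfer *-multiplication domain with respect to the restriction of *: for every nonzero finitely generated D-submodule F of K, (F(D : F))^* = D. -/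
open scoped Pointwise

section Semistar

variable (A K : Type*) [CommRing A] [Field K] [Algebra A K]

/-- A semistar operation on the domain `A` (inside `K`): a map on nonzero `A`-submodules of
`K` satisfying `(aF)^* = aF^*`, `F ⊆ F^*`, monotonicity, and idempotency. -/
structure SemistarOp : Type _ where
  star : Submodule A K → Submodule A K
  star_ne_bot : ∀ F : Submodule A K, F ≠ ⊥ → star F ≠ ⊥
  star_smul : ∀ (a : K), a ≠ 0 → ∀ F : Submodule A K, F ≠ ⊥ → star (a • F) = a • star F
  le_star : ∀ F : Submodule A K, F ≠ ⊥ → F ≤ star F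
  star_mono : ∀ F G : Submodule A K, F ≠ ⊥ → G ≠ ⊥ → F ≤ G → star F ≤ star G
  star_star : ∀ F : Submodule A K, F ≠ ⊥ → star (star F) = star F

end Semistar

open Polynomial in
theorem Ideal.mem_radical_of_forall_smul_mem_smul_top {A M : Type*} [CommRing A] [AddCommGroup M]
    [Module A M] [Module.Finite A M] [FaithfulSMul A M] {I : Ideal A} {r : A}
    (h : ∀ m : M, r • m ∈ I • (⊤ : Submodule A M)) : r ∈ I.radical := by
  obtain ⟨p, hp, -, hcoeff, hzero⟩ :=
    LinearMap.exists_monic_and_natDegree_eq_and_coeff_mem_pow_and_aeval_eq_zero A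
      (algebraMap A (Module.End A M) r) I (by rintro _ ⟨m, rfl⟩; exact h m)
  have heval : p.eval r = 0 := by
    rw [aeval_algebraMap_apply_eq_algebraMap_eval] at hzero
    refine FaithfulSMul.eq_of_smul_eq_smul (α := M) fun m ↦ ?_
    simpa using LinearMap.congr_fun hzero m
  refine ⟨p.natDegree, ?_⟩
  rw [hp.as_sum, eval_add, eval_finsetSum] at heval
  simp only [eval_pow, eval_X, eval_mul, eval_C] at heval
  rw [eq_neg_of_add_eq_zero_left heval]
  refine I.neg_mem (I.sum_mem fun k hk ↦ I.mul_mem_right _ ?_)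
  exact Ideal.pow_le_self (Nat.sub_ne_zero_of_lt (Finset.mem_range.mp hk)) (hcoeff k)

namespace Submodule

variable {R K : Type*} [CommRing R] [Field K] [Algebra R K]

theorem mul_ne_bot {A B : Submodule R K} (hA : A ≠ ⊥) (hB : B ≠ ⊥) : A * B ≠ ⊥ := by
  obtain ⟨a, ha, ha0⟩ := (Submodule.ne_bot_iff A).mp hA
  obtain ⟨b, hb, hb0⟩ := B.ne_bot_iff.mp hB
  exact (A * B).ne_bot_iff.mpr ⟨a * b, mul_mem_mul ha hb, mul_ne_zero ha0 hb0⟩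

theorem smul_ne_bot {a : K} (ha : a ≠ 0) {F : Submodule R K} (hF : F ≠ ⊥) : a • F ≠ ⊥ := by
  obtain ⟨x, hx, hx0⟩ := F.ne_bot_iff.mp hF
  exact (a • F).ne_bot_iff.mpr ⟨a • x, smul_mem_pointwise_smul x a F hx, mul_ne_zero ha hx0⟩

theorem one_ne_bot : (1 : Submodule R K) ≠ ⊥ :=
  (Submodule.ne_bot_iff _).mpr ⟨1, Submodule.one_le.mp le_rfl, one_ne_zero⟩

theorem inf_ne_bot_of_isFractionRing [IsDomain R] [IsFractionRing R K] {A B : Submodule R K}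
    (hA : A ≠ ⊥) (hB : B ≠ ⊥) : A ⊓ B ≠ ⊥ := by
  obtain ⟨a, ha, ha0⟩ := (Submodule.ne_bot_iff A).mp hA
  obtain ⟨b, hb, hb0⟩ := B.ne_bot_iff.mp hB
  obtain ⟨p, q, hq, hpq⟩ := IsFractionRing.div_surjective (A := R) (a / b)
  have hq0 : algebraMap R K q ≠ 0 := IsLocalization.to_map_ne_zero_of_mem_nonZeroDivisors K le_rfl hq
  have heq : q • a = p • b := by
    rw [Algebra.smul_def, Algebra.smul_def]
    field_simp at hpq
    linear_combination -hpq
  refine (Submodule.ne_bot_iff _).mpr ⟨q • a, ⟨A.smul_mem q ha, ?_⟩, ?_⟩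
  · exact heq ▸ B.smul_mem p hb
  · rw [Algebra.smul_def]
    exact mul_ne_zero hq0 ha0

theorem FG.isFrac [IsDomain R] [IsFractionRing R K] {I : Submodule R K} (hI : I.FG)
    (h0 : I ≠ ⊥) : IsFrac R K I := by
  obtain ⟨d, hd, h⟩ := FractionalIdeal.isFractional_of_fg (S := nonZeroDivisors R) hI
  refine ⟨h0, d, nonZeroDivisors.ne_zero hd, fun x hx ↦ ?_⟩
  obtain ⟨a, ha⟩ := h x hx
  exact ⟨a, by rw [ha, Algebra.smul_def]⟩

end Submodule

namespace SemistarOp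

open Submodule

section

variable {R K : Type*} [CommRing R] [Field K] [Algebra R K] (s : SemistarOp R K)

/-- A semistar operation is of finite type if `F^*` is the union of the `J^*` for `J ⊆ F`
nonzero and finitely generated. -/
def IsFiniteType : Prop :=
  ∀ F : Submodule R K, F ≠ ⊥ →
    s.star F = ⨆ J ∈ {J : Submodule R K | J ≠ ⊥ ∧ J.FG ∧ J ≤ F}, s.star J

/-- The `*`-integral closure of `R`, as a set. -/
def integralClosureSet : Set K :=
  {x : K | ∃ J : Submodule R K, J ≠ ⊥ ∧ J.FG ∧ ∀ y ∈ s.star J, x * y ∈ s.star J}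

variable {s} {F G : Submodule R K}

theorem star_le_star (hF : F ≠ ⊥) (hG : G ≠ ⊥) (h : F ≤ s.star G) : s.star F ≤ s.star G := by
  rw [← s.star_star G hG]
  exact s.star_mono F _ hF (s.star_ne_bot G hG) h

theorem mul_mem_star (hF : F ≠ ⊥) (hG : G ≠ ⊥) {a y : K} (h : ∀ x ∈ F, a * x ∈ s.star G)
    (hy : y ∈ s.star F) : a * y ∈ s.star G := by
  rcases eq_or_ne a 0 with rfl | ha
  · simp
  have hle : a • F ≤ s.star G := by
    intro z hz
    obtain ⟨x, hx, rfl⟩ := (mem_smul_pointwise_iff_exists ..).mp hz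
    exact h x hx
  refine star_le_star (smul_ne_bot ha hF) hG hle ?_
  rw [s.star_smul a ha F hF]
  exact smul_mem_pointwise_smul y a _ hy

theorem mul_mem_star_mul (hF : F ≠ ⊥) (hG : G ≠ ⊥) {x y : K} (hx : x ∈ s.star F)
    (hy : y ∈ s.star G) : x * y ∈ s.star (F * G) := by
  have hFG := mul_ne_bot hF hG
  refine mul_mem_star hG hFG (fun g hg ↦ ?_) hy
  rw [mul_comm x g]
  refine mul_mem_star hF hFG (fun f hf ↦ ?_) hx
  rw [mul_comm g f]
  exact s.le_star _ hFG (mul_mem_mul hf hg)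

theorem exists_fg_mem_star (hft : s.IsFiniteType) (hF : F ≠ ⊥) {x : K} (hx : x ∈ s.star F) :
    ∃ J : Submodule R K, J ≠ ⊥ ∧ J.FG ∧ J ≤ F ∧ x ∈ s.star J := by
  rw [hft F hF, iSup_subtype'] at hx
  obtain ⟨y, hy, hy0⟩ := F.ne_bot_iff.mp hF
  have : Nonempty {J : Submodule R K | J ≠ ⊥ ∧ J.FG ∧ J ≤ F} :=
    ⟨⟨span R {y}, by simpa using hy0, fg_span_singleton y, by simpa using hy⟩⟩
  obtain ⟨⟨J, hJ0, hJ, hJF⟩, hxJ⟩ := (mem_iSup_of_directed _ fun A B ↦ by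
    have h0 : A.1 ⊔ B.1 ≠ ⊥ := ne_bot_of_le_ne_bot A.2.1 le_sup_left
    exact ⟨⟨A.1 ⊔ B.1, h0, A.2.2.1.sup B.2.2.1, sup_le A.2.2.2 B.2.2.2⟩,
      s.star_mono _ _ A.2.1 h0 le_sup_left, s.star_mono _ _ B.2.1 h0 le_sup_right⟩).mp hx
  exact ⟨J, hJ0, hJ, hJF, hxJ⟩

theorem mul_mem_star_mul_of_forall (hF : F ≠ ⊥) (hG : G ≠ ⊥) {x : K}
    (h : ∀ y ∈ s.star F, x * y ∈ s.star F) :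
    ∀ y ∈ s.star (F * G), x * y ∈ s.star (F * G) := by
  have hFG := mul_ne_bot hF hG
  intro y hy
  refine mul_mem_star hFG hFG (fun z hz ↦ ?_) hy
  induction hz using Submodule.mul_induction_on' with
  | mem_mul_mem f hf g hg =>
    rw [← mul_assoc]
    exact mul_mem_star_mul hF hG (h f (s.le_star F hF hf)) (s.le_star G hG hg)
  | add a _ b _ ha hb => rw [mul_add]; exact add_mem ha hb

theorem exists_common_of_mem_integralClosureSet {x y : K} (hx : x ∈ s.integralClosureSet)
    (hy : y ∈ s.integralClosureSet) :
    ∃ J : Submodule R K, J ≠ ⊥ ∧ J.FG ∧ (∀ z ∈ s.star J, x * z ∈ s.star J) ∧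
      ∀ z ∈ s.star J, y * z ∈ s.star J := by
  obtain ⟨A, hA0, hA, hxA⟩ := hx
  obtain ⟨B, hB0, hB, hyB⟩ := hy
  refine ⟨A * B, mul_ne_bot hA0 hB0, hA.mul hB, mul_mem_star_mul_of_forall hA0 hB0 hxA, ?_⟩
  rw [mul_comm A B]
  exact mul_mem_star_mul_of_forall hB0 hA0 hyB

variable (s) in
/-- The `*`-integral closure of `R`, as a subalgebra. -/
def integralClosure : Subalgebra R K where
  carrier := s.integralClosureSet
  mul_mem' hx hy := by
    obtain ⟨J, hJ0, hJ, hxJ, hyJ⟩ := exists_common_of_mem_integralClosureSet hx hy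
    exact ⟨J, hJ0, hJ, fun z hz ↦ by rw [mul_assoc]; exact hxJ _ (hyJ z hz)⟩
  add_mem' hx hy := by
    obtain ⟨J, hJ0, hJ, hxJ, hyJ⟩ := exists_common_of_mem_integralClosureSet hx hy
    exact ⟨J, hJ0, hJ, fun z hz ↦ by rw [add_mul]; exact add_mem (hxJ z hz) (hyJ z hz)⟩
  algebraMap_mem' r := ⟨1, one_ne_bot, ⟨{1}, by rw [Finset.coe_singleton, one_eq_span]⟩, fun y hy ↦ by
    rw [← Algebra.smul_def]; exact Submodule.smul_mem _ r hy⟩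

theorem exists_forall_mul_mem_star {L : Submodule R K} (hL : L.FG)
    (hLD : L ≤ Subalgebra.toSubmodule s.integralClosure) :
    ∃ J : Submodule R K, J ≠ ⊥ ∧ J.FG ∧ ∀ x ∈ L, ∀ y ∈ s.star J, x * y ∈ s.star J := by
  induction L, hL using Submodule.fg_induction with
  | singleton x =>
    obtain ⟨J, hJ0, hJ, hx⟩ : x ∈ s.integralClosureSet := hLD (mem_span_singleton_self x)
    refine ⟨J, hJ0, hJ, fun z hz y hy ↦ ?_⟩
    obtain ⟨r, rfl⟩ := mem_span_singleton.mp hz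
    rw [smul_mul_assoc]
    exact Submodule.smul_mem _ r (hx y hy)
  | sup A B _ _ hA hB =>
    obtain ⟨I, hI0, hI, hAI⟩ := hA (le_sup_left.trans hLD)
    obtain ⟨J, hJ0, hJ, hBJ⟩ := hB (le_sup_right.trans hLD)
    refine ⟨I * J, mul_ne_bot hI0 hJ0, hI.mul hJ, fun x hx y hy ↦ ?_⟩
    obtain ⟨a, ha, b, hb, rfl⟩ := mem_sup.mp hx
    rw [add_mul]
    refine add_mem (mul_mem_star_mul_of_forall hI0 hJ0 (hAI a ha) y hy) ?_
    rw [mul_comm I J] at hy ⊢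
    exact mul_mem_star_mul_of_forall hJ0 hI0 (hBJ b hb) y hy

theorem toSubmodule_ne_bot (D : Subalgebra R K) : Subalgebra.toSubmodule D ≠ ⊥ :=
  (Submodule.ne_bot_iff _).mpr ⟨1, D.one_mem, one_ne_zero⟩

theorem star_integralClosure (hft : s.IsFiniteType) :
    s.star (Subalgebra.toSubmodule s.integralClosure) =
      Subalgebra.toSubmodule s.integralClosure := by
  refine le_antisymm (fun x hx ↦ ?_) (s.le_star _ (toSubmodule_ne_bot _))
  obtain ⟨L, hL0, hL, hLD, hxL⟩ := exists_fg_mem_star hft (toSubmodule_ne_bot _) hx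
  obtain ⟨J, hJ0, hJ, hLJ⟩ := exists_forall_mul_mem_star hL hLD
  refine ⟨J, hJ0, hJ, fun y hy ↦ ?_⟩
  rw [mul_comm]
  refine mul_mem_star hL0 hJ0 (fun l hl ↦ ?_) hxL
  rw [mul_comm]
  exact hLJ l hl y hy

end

variable {R K : Type*} [CommRing R] [Field K] [Algebra R K] {s : SemistarOp R K}

theorem one_mem_star_div_inf_one [IsDomain R] [IsFractionRing R K]
    (hinter : ∀ F G : Submodule R K, F ≠ ⊥ → G ≠ ⊥ → s.star (F ⊓ G) = s.star F ⊓ s.star G)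
    {F I : Submodule R K} (hF : F ≠ ⊥) (hI : I.FG) (hIF : I ≤ s.star F) :
    F / I ⊓ 1 ≠ ⊥ ∧ (1 : K) ∈ s.star (F / I ⊓ 1) := by
  have hone : (1 : K) ∈ s.star 1 := s.le_star 1 one_ne_bot (one_le.mp le_rfl)
  induction I, hI using Submodule.fg_induction with
  | singleton x =>
    rcases eq_or_ne x 0 with rfl | hx
    · have h : F / span R {0} ⊓ 1 = 1 := by
        refine inf_eq_right.mpr fun k _ ↦ mem_div_iff_forall_mul_mem.mpr fun y hy ↦ ?_
        obtain rfl : y = 0 := by simpa using hy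
        simp
      rw [h]
      exact ⟨one_ne_bot, hone⟩
    · have hle : x⁻¹ • F ≤ F / span R {x} := by
        intro z hz
        obtain ⟨f, hf, rfl⟩ := (mem_smul_pointwise_iff_exists ..).mp hz
        refine mem_div_iff_forall_mul_mem.mpr fun y hy ↦ ?_
        obtain ⟨r, rfl⟩ := mem_span_singleton.mp hy
        have h : x⁻¹ • f * r • x = r • f := by
          rw [smul_eq_mul, mul_smul_comm, mul_right_comm, inv_mul_cancel₀ hx, one_mul]
        exact h ▸ F.smul_mem r hf
      have h0 := smul_ne_bot (inv_ne_zero hx) hF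
      have h0' := ne_bot_of_le_ne_bot h0 hle
      refine ⟨inf_ne_bot_of_isFractionRing h0' one_ne_bot, ?_⟩
      rw [hinter _ _ h0' one_ne_bot]
      refine ⟨s.star_mono _ _ h0 h0' hle ?_, hone⟩
      rw [s.star_smul _ (inv_ne_zero hx) F hF]
      exact (mem_smul_pointwise_iff_exists ..).mpr
        ⟨x, hIF (mem_span_singleton_self x), inv_mul_cancel₀ hx⟩
  | sup A B _ _ hA hB =>
    obtain ⟨hA0, hA1⟩ := hA (le_sup_left.trans hIF)
    obtain ⟨hB0, hB1⟩ := hB (le_sup_right.trans hIF)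
    have h0 := inf_ne_bot_of_isFractionRing hA0 hB0
    have hle : (F / A ⊓ 1) ⊓ (F / B ⊓ 1) ≤ F / (A ⊔ B) ⊓ 1 := by
      rintro k ⟨⟨hkA, hk⟩, hkB, -⟩
      refine ⟨mem_div_iff_forall_mul_mem.mpr fun y hy ↦ ?_, hk⟩
      obtain ⟨a, ha, b, hb, rfl⟩ := mem_sup.mp hy
      rw [mul_add]
      exact add_mem (mem_div_iff_forall_mul_mem.mp hkA a ha)
        (mem_div_iff_forall_mul_mem.mp hkB b hb)
    have h1 := ne_bot_of_le_ne_bot h0 hle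
    refine ⟨h1, s.star_mono _ _ h0 h1 hle ?_⟩
    rw [hinter _ _ hA0 hB0]
    exact ⟨hA1, hB1⟩

theorem coeSubmodule_ne_bot_and_one_mem_star_pow {I : Ideal R}
    (h0 : IsLocalization.coeSubmodule K I ≠ ⊥)
    (h1 : (1 : K) ∈ s.star (IsLocalization.coeSubmodule K I)) (n : ℕ) :
    IsLocalization.coeSubmodule K (I ^ n) ≠ ⊥ ∧
      (1 : K) ∈ s.star (IsLocalization.coeSubmodule K (I ^ n)) := by
  induction n with
  | zero =>
    rw [pow_zero, Ideal.one_eq_top, IsLocalization.coeSubmodule_top]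
    exact ⟨one_ne_bot, s.le_star 1 one_ne_bot (one_le.mp le_rfl)⟩
  | succ n ih =>
    rw [pow_succ, IsLocalization.coeSubmodule_mul]
    refine ⟨mul_ne_bot ih.1 h0, ?_⟩
    simpa using mul_mem_star_mul ih.1 h0 ih.2 h1

/-- If `*` is spectral of finite type and `C` is an ideal with `C^* ∋ 1` lying in the radical of an
ideal `L`, then `L^* ∋ 1`. -/
theorem one_mem_star_of_le_radical [IsDomain R] [IsFractionRing R K] (hft : s.IsFiniteType)
    {C : Submodule R K} (hC0 : C ≠ ⊥) (hC : C ≤ 1) (hC1 : (1 : K) ∈ s.star C)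
    {W : Submodule R K} (hW0 : W ≠ ⊥)
    (h : ∀ r : R, algebraMap R K r ∈ C →
      r ∈ Ideal.radical (W.comap (Algebra.linearMap R K))) :
    (1 : K) ∈ s.star W := by
  obtain ⟨H, hH0, hH, hHC, hH1⟩ := exists_fg_mem_star hft hC0 hC1
  set I : Ideal R := H.comap (Algebra.linearMap R K)
  have hI : IsLocalization.coeSubmodule K I = H := by
    refine map_comap_eq_self ?_
    rw [← one_eq_range]
    exact hHC.trans hC
  have hIfg : I.FG := (IsLocalization.coeSubmodule_fg K (IsFractionRing.injective R K) I).mp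
    (hI ▸ hH)
  obtain ⟨n, hn⟩ := Ideal.exists_pow_le_of_le_radical_of_fg (fun r hr ↦ h r (hHC hr)) hIfg
  obtain ⟨h0, h1⟩ := coeSubmodule_ne_bot_and_one_mem_star_pow (hI ▸ hH0) (hI ▸ hH1) n
  exact s.star_mono _ _ h0 hW0 (map_le_iff_le_comap.mpr hn) h1

end SemistarOp

open Submodule SemistarOp in
/-- Let `*` be a semistar operation on `R` with `R^* = R` which is of
finite type and distributes over finite intersections (i.e. is spectral and of finite type).
If `R` is Clifford `*`-regular, then the `*`-integral closure
`D = {x ∈ K : xJ^* ⊆ J^* for some nonzero finitely generated ideal J of R}` is a subring of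
`K` containing `R` with `D^* = D`, and `D` is a Prüfer `*`-multiplication domain with respect
to the restriction of `*`: `(F(D : F))^* = D` for every nonzero finitely generated
`D`-submodule `F` of `K`. -/
theorem star_integral_closure_is_pstarmd
    {R K : Type*} [CommRing R] [IsDomain R] [Field K] [Algebra R K] [IsFractionRing R K]
    (s : SemistarOp R K) (hone : s.star (1 : Submodule R K) = 1)
    (hft : ∀ F : Submodule R K, F ≠ ⊥ →
      s.star F = ⨆ J ∈ {J : Submodule R K | J ≠ ⊥ ∧ J.FG ∧ J ≤ F}, s.star J)
    (hinter : ∀ F G : Submodule R K, F ≠ ⊥ → G ≠ ⊥ → s.star (F ⊓ G) = s.star F ⊓ s.star G)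
    (hreg : ∀ I : Submodule R K, IsFrac R K I →
      ∃ J : Submodule R K, IsFrac R K J ∧ s.star I = s.star (I * I * J)) :
    ∃ D : Subalgebra R K,
      (D : Set K) =
        {x : K | ∃ J : Submodule R K, J ≠ ⊥ ∧ J.FG ∧ ∀ y ∈ s.star J, x * y ∈ s.star J} ∧
      s.star (Subalgebra.toSubmodule D) = Subalgebra.toSubmodule D ∧
      ∀ F : Submodule D K, F ≠ ⊥ → F.FG →
        s.star (Submodule.span R (F : Set K) *
            (Subalgebra.toSubmodule D / Submodule.span R (F : Set K)))
          = Subalgebra.toSubmodule D := by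
  have hft' : s.IsFiniteType := hft
  have hDstar := star_integralClosure hft'
  set D := s.integralClosure
  refine ⟨D, rfl, hDstar, fun F hF0 hF ↦ ?_⟩
  set G : Submodule R K := span R (F : Set K)
  have hGF : ∀ {x}, x ∈ G ↔ x ∈ F := fun {x} ↦
    ⟨fun hx ↦ (span_le (p := F.restrictScalars R)).mpr subset_rfl hx, fun hx ↦ subset_span hx⟩
  set W : Submodule R K := G * (Subalgebra.toSubmodule D / G)
  have hWD : W ≤ Subalgebra.toSubmodule D := mul_le.mpr fun g hg q hq ↦ by
    rw [mul_comm]; exact mem_div_iff_forall_mul_mem.mp hq g hg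
  have hmulW : ∀ d ∈ D, ∀ w ∈ W, d * w ∈ W := fun d hd w hw ↦ by
    induction hw using Submodule.mul_induction_on' with
    | mem_mul_mem g hg q hq =>
      rw [← mul_assoc]
      exact mul_mem_mul (hGF.mpr (F.smul_mem (⟨d, hd⟩ : D) (hGF.mp hg))) hq
    | add a _ b _ ha hb => rw [mul_add]; exact add_mem ha hb
  obtain ⟨S, hS⟩ := hF
  set I : Submodule R K := span R (S : Set K)
  have hIfg : I.FG := ⟨S, rfl⟩
  have hSF : (S : Set K) ⊆ F := hS ▸ subset_span
  have hI0 : I ≠ ⊥ := by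
    intro h
    refine hF0 (hS ▸ span_eq_bot.mpr fun x hx ↦ ?_)
    exact (mem_bot R).mp (h ▸ subset_span hx)
  have hIG : I ≤ G := span_mono hSF
  obtain ⟨J, ⟨hJ0, -⟩, hJ⟩ := hreg I (hIfg.isFrac hI0)
  have hIIJ0 : I * I * J ≠ ⊥ := mul_ne_bot (mul_ne_bot hI0 hI0) hJ0
  have hIJ0 : I * J ≠ ⊥ := mul_ne_bot hI0 hJ0
  have hmulIJ : ∀ j ∈ J, ∀ i ∈ I, j * i ∈ D := fun j hj i hi ↦ by
    refine ⟨I, hI0, hIfg, fun y hy ↦ mul_mem_star hI0 hI0 (fun x hx ↦ ?_) hy⟩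
    have h : j * i * x = i * x * j := by ring
    rw [h, hJ]
    exact s.le_star _ hIIJ0 (mul_mem_mul (mul_mem_mul hi hx) hj)
  have hJG : J ≤ Subalgebra.toSubmodule D / G := fun j hj ↦ by
    refine mem_div_iff_forall_mul_mem.mpr fun y hy ↦ ?_
    have hy' : y ∈ span D (S : Set K) := hS ▸ hGF.mp hy
    induction hy' using span_induction with
    | mem x hx => exact hmulIJ j hj x (subset_span hx)
    | zero => simp
    | add a b ha hb iha ihb =>
      rw [mul_add]
      exact add_mem (iha (hGF.mpr (hS ▸ ha))) (ihb (hGF.mpr (hS ▸ hb)))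
    | smul d x hx ih =>
      rw [mul_smul_comm]
      exact D.mul_mem d.2 (ih (hGF.mpr (hS ▸ hx)))
  have hIJW : I * J ≤ W := mul_le_mul' hIG hJG
  have hW0 : W ≠ ⊥ := ne_bot_of_le_ne_bot hIJ0 hIJW
  refine le_antisymm ?_ fun d hd ↦ ?_
  · exact (s.star_mono _ _ hW0 (toSubmodule_ne_bot D) hWD).trans_eq hDstar
  suffices h1 : (1 : K) ∈ s.star W by
    rw [← mul_one d]
    exact mul_mem_star hW0 hW0 (fun w hw ↦ s.le_star W hW0 (hmulW d hd w hw)) h1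
  obtain ⟨hC0, hC1⟩ := one_mem_star_div_inf_one hinter hIIJ0 hIfg
    (hJ ▸ s.le_star I hI0)
  refine one_mem_star_of_le_radical hft' hC0 inf_le_right hC1 hW0 fun r hr ↦ ?_
  let T : Ideal D :=
    { carrier := {t | (t : K) ∈ W}
      add_mem' := fun ha hb ↦ W.add_mem ha hb
      zero_mem' := W.zero_mem
      smul_mem' := fun d t ht ↦ hmulW d d.2 t ht }
  have hrF : ∀ x ∈ F, algebraMap R D r • x ∈ T • F := fun x hx ↦ by
    rw [← hS] at hx
    induction hx using span_induction with
    | mem x hx =>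
      have hle : I * I * J ≤ (T • F).restrictScalars R := by
        rw [mul_right_comm]
        refine mul_le.mpr fun w hw i hi ↦ ?_
        exact smul_mem_smul (I := T) (r := ⟨w, hWD (hIJW hw)⟩) (hIJW hw) (hGF.mp (hIG hi))
      exact hle (mem_div_iff_forall_mul_mem.mp hr.1 x (subset_span hx))
    | zero => simp
    | add a b _ _ ha hb => rw [smul_add]; exact add_mem ha hb
    | smul d x _ hx => rw [smul_comm]; exact Submodule.smul_mem _ d hx
  have : Module.Finite D F := Module.Finite.iff_fg.mpr ⟨S, hS⟩
  have : FaithfulSMul D F := by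
    obtain ⟨x, hx, hx0⟩ := F.ne_bot_iff.mp hF0
    refine ⟨fun {a b} hab ↦ Subtype.ext ?_⟩
    exact mul_right_cancel₀ hx0 (congrArg Subtype.val (hab ⟨x, hx⟩))
  obtain ⟨n, hn⟩ := Ideal.mem_radical_of_forall_smul_mem_smul_top (I := T) (M := F)
    (r := algebraMap R D r) fun m ↦ (mem_smul_top_iff T F _).mpr (hrF m m.2)
  refine ⟨n, ?_⟩
  have hn' : ((algebraMap R D r ^ n : D) : K) ∈ W := hn
  simpa using hn'
end

section
/- Let R be an integral domain and * a star operation of finite type on R. If R is *-integrally closed, i.e. (J^* : J^*) = R for every nonzero finitely generated R-submodule J of K, and R is Clifford *-regular, then R is a Prüfer v-multiplication domain: (J(R : J))^t = R for every nonzero finitely generated ideal J of R. -/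
open scoped Pointwise

section Star

variable (R K : Type*) [CommRing R] [IsDomain R] [Field K] [Algebra R K] [IsFractionRing R K]

/-- A star operation on the domain `R` with quotient field `K`: a map on (nonzero)
fractional ideals satisfying `(aI)^* = aI^*`, `R^* = R`, `I ⊆ I^*`, monotonicity and
idempotency. -/
structure StarOperation : Type _ where
  star : Submodule R K → Submodule R K
  star_frac : ∀ I, IsFrac R K I → IsFrac R K (star I)
  star_smul : ∀ (a : K), a ≠ 0 → ∀ I, IsFrac R K I → star (a • I) = a • star I
  star_one : star (1 : Submodule R K) = 1
  le_star : ∀ I, IsFrac R K I → I ≤ star I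
  star_mono : ∀ I J, IsFrac R K I → IsFrac R K J → I ≤ J → star I ≤ star J
  star_star : ∀ I, IsFrac R K I → star (star I) = star I

variable {R K}

/-- `*` is of finite type: `I^* = ⋃ {J^* : J ⊆ I nonzero finitely generated}`. -/
def StarOperation.FiniteType (s : StarOperation R K) : Prop :=
  ∀ I, IsFrac R K I →
    s.star I = ⨆ J ∈ {J : Submodule R K | J ≠ ⊥ ∧ J.FG ∧ J ≤ I}, s.star J

/-- `I` is `*`-stable: with `E := (I^* : I^*)`, one has `(I^*(E : I^*))^* = E`. -/
def StarOperation.Stable (s : StarOperation R K) (I : Submodule R K) : Prop :=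
  s.star (s.star I * ((s.star I / s.star I) / s.star I)) = s.star I / s.star I

/-- `I` is Clifford `*`-regular: `I^* = (I²J)^*` for some nonzero ideal `J`. -/
def StarOperation.Regular (s : StarOperation R K) (I : Submodule R K) : Prop :=
  ∃ J : Submodule R K, IsFrac R K J ∧ s.star I = s.star (I * I * J)

/-- `I` is Boole `*`-regular: `(I²)^* = xI^*` for some nonzero `x ∈ K`. -/
def StarOperation.BooleRegular (s : StarOperation R K) (I : Submodule R K) : Prop :=
  ∃ x : K, x ≠ 0 ∧ s.star (I * I) = x • s.star I

/-- `I` is strongly `*`-stable: `I^* = xE` for some nonzero `x ∈ K`, where `E = (I^* : I^*)`. -/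
def StarOperation.StronglyStable (s : StarOperation R K) (I : Submodule R K) : Prop :=
  ∃ x : K, x ≠ 0 ∧ s.star I = x • (s.star I / s.star I)

end Star

section Auxiliary

open scoped nonZeroDivisors

variable {R K : Type*} [CommRing R] [Field K] [Algebra R K]

theorem IsFrac.of_le {I J : Submodule R K} (hJ : IsFrac R K J) (hI : I ≠ ⊥) (h : I ≤ J) :
    IsFrac R K I := by
  obtain ⟨-, d, hd, hJ⟩ := hJ
  exact ⟨hI, d, hd, fun x hx => hJ x (h hx)⟩

theorem IsFrac.mul [IsDomain R] {I J : Submodule R K} (hI : IsFrac R K I) (hJ : IsFrac R K J) :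
    IsFrac R K (I * J) := by
  obtain ⟨hI0, d, hd, hI⟩ := hI
  obtain ⟨hJ0, e, he, hJ⟩ := hJ
  refine ⟨mul_ne_zero hI0 hJ0, d * e, mul_ne_zero hd he, fun x hx => ?_⟩
  induction hx using Submodule.mul_induction_on' with
  | mem_mul_mem m hm n hn =>
    obtain ⟨a, ha⟩ := hI m hm
    obtain ⟨b, hb⟩ := hJ n hn
    exact ⟨a * b, by rw [map_mul, map_mul, ← ha, ← hb]; ring⟩
  | add x _ y _ hx hy =>
    obtain ⟨a, ha⟩ := hx
    obtain ⟨b, hb⟩ := hy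
    exact ⟨a + b, by rw [mul_add, map_add, ha, hb]⟩

theorem smul_pointwise_ne_bot {a : K} (ha : a ≠ 0) {I : Submodule R K} (hI : I ≠ ⊥) :
    a • I ≠ ⊥ := by
  obtain ⟨x, hx, hx0⟩ := (Submodule.ne_bot_iff _).1 hI
  exact (Submodule.ne_bot_iff _).2
    ⟨a * x, Submodule.smul_mem_pointwise_smul x a I hx, mul_ne_zero ha hx0⟩

theorem isFrac_of_fg [IsDomain R] [IsFractionRing R K] {I : Submodule R K} (hI : I ≠ ⊥)
    (hfg : I.FG) : IsFrac R K I := by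
  obtain ⟨d, hd, h⟩ := FractionalIdeal.isFractional_of_fg (S := R⁰) hfg
  refine ⟨hI, d, nonZeroDivisors.ne_zero hd, fun x hx => ?_⟩
  obtain ⟨a, ha⟩ := h x hx
  exact ⟨a, by rw [ha, Algebra.smul_def]⟩

theorem vS_le_one {I : Submodule R K} (hI : I ≤ 1) : vS R K I ≤ 1 := by
  have h : (1 : Submodule R K) ≤ 1 / I := by rwa [Submodule.le_div_iff_mul_le, one_mul]
  intro x hx
  simpa using Submodule.mem_div_iff_forall_mul_mem.1 hx 1 (h (Submodule.one_le.1 le_rfl))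

theorem tS_le_one {I : Submodule R K} (hI : I ≤ 1) : tS R K I ≤ 1 :=
  iSup₂_le fun _ hJ => vS_le_one (hJ.2.2.trans hI)

/-- A finitely generated submodule of `I * J` is contained in `I * F` for some finitely
generated `F ≤ J`. -/
theorem Submodule.FG.exists_fg_le_mul {G I J : Submodule R K} (hG : G.FG) (h : G ≤ I * J) :
    ∃ F : Submodule R K, F.FG ∧ F ≤ J ∧ G ≤ I * F := by
  have hle : G ≤ ⨆ x : J, I * Submodule.span R {(x : K)} :=
    h.trans <| Submodule.mul_le.2 fun m hm n hn =>
      le_iSup (fun x : J => I * Submodule.span R {(x : K)}) ⟨n, hn⟩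
        (Submodule.mul_mem_mul hm (Submodule.mem_span_singleton_self n))
  obtain ⟨t, ht⟩ :=
    CompleteLattice.IsCompactElement.exists_finset_of_le_iSup _
      ((Submodule.fg_iff_compact G).1 hG) _ hle
  refine ⟨⨆ x ∈ t, Submodule.span R {(x : K)},
    Submodule.fg_biSup t _ fun x _ => Submodule.fg_span_singleton _,
    iSup₂_le fun x _ => (Submodule.span_singleton_le_iff_mem _ _).2 x.2,
    ht.trans (iSup₂_le fun x hx => mul_le_mul' le_rfl
      (le_iSup₂_of_le x hx le_rfl))⟩

namespace StarOperation

variable (s : StarOperation R K)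

/-- If `aI ⊆ J^*` then `aI^* ⊆ J^*`. -/
theorem smul_star_le {I J : Submodule R K} (hI : IsFrac R K I) (hJ : IsFrac R K J) {a : K}
    (h : a • I ≤ s.star J) : a • s.star I ≤ s.star J := by
  rcases eq_or_ne a 0 with rfl | ha
  · rintro _ ⟨x, -, rfl⟩
    simp
  have hs := s.star_frac J hJ
  rw [← s.star_smul a ha I hI, ← s.star_star J hJ]
  exact s.star_mono _ _ (hs.of_le (smul_pointwise_ne_bot ha hI.1) h) hs h

theorem mem_star_div_star {I : Submodule R K} (hI : IsFrac R K I) {a : K}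
    (h : a • I ≤ s.star I) : a ∈ s.star I / s.star I :=
  Submodule.mem_div_iff_forall_mul_mem.2 fun x hx =>
    s.smul_star_le hI hI h (Submodule.smul_mem_pointwise_smul x a _ hx)

variable {s} in
theorem FiniteType.exists_fg_le_star (hft : s.FiniteType) {I J : Submodule R K}
    (hI : IsFrac R K I) (hJ0 : J ≠ ⊥) (hJ : J.FG) (h : J ≤ s.star I) :
    ∃ G : Submodule R K, G ≠ ⊥ ∧ G.FG ∧ G ≤ I ∧ J ≤ s.star G := by
  rw [hft I hI, iSup_subtype'] at h
  obtain ⟨t, ht⟩ :=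
    CompleteLattice.IsCompactElement.exists_finset_of_le_iSup _
      ((Submodule.fg_iff_compact J).1 hJ) _ h
  have hle : (⨆ F ∈ t, (F : Submodule R K)) ≤ I := iSup₂_le fun F _ => F.2.2.2
  have hne : (⨆ F ∈ t, (F : Submodule R K)) ≠ ⊥ := by
    rcases t.eq_empty_or_nonempty with rfl | ⟨F, hF⟩
    · exact absurd (le_bot_iff.1 (by simpa using ht)) hJ0
    · exact ne_bot_of_le_ne_bot F.2.1 (le_iSup₂_of_le F hF le_rfl)
  exact ⟨⨆ F ∈ t, (F : Submodule R K), hne, Submodule.fg_biSup t _ fun F _ => F.2.2.1, hle,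
    ht.trans (iSup₂_le fun F hF => s.star_mono _ _ (hI.of_le F.2.1 F.2.2.2) (hI.of_le hne hle)
      (le_iSup₂_of_le F hF le_rfl))⟩

end StarOperation

end Auxiliary

/-- Let `*` be a star operation of finite type on `R`. If `R` is
`*`-integrally closed (`(J^* : J^*) = R` for every nonzero finitely generated `R`-submodule
`J` of `K`) and Clifford `*`-regular, then `R` is a Prüfer `v`-multiplication domain:
`(J(R : J))^t = R` for every nonzero finitely generated ideal `J` of `R`. -/
theorem pvmd_of_star_integrally_closed_regular
    {R K : Type*} [CommRing R] [IsDomain R] [Field K] [Algebra R K] [IsFractionRing R K]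
    (s : StarOperation R K) (hft : s.FiniteType)
    (hic : ∀ J : Submodule R K, J ≠ ⊥ → J.FG → s.star J / s.star J = 1)
    (hreg : ∀ I : Submodule R K, IsFrac R K I → s.Regular I) :
    ∀ J : Submodule R K, J ≠ ⊥ → J.FG → tS R K (J * (1 / J)) = 1 := by
  intro J hJ0 hJfg
  refine le_antisymm (tS_le_one Submodule.mul_one_div_le_one) ?_
  have hJ := isFrac_of_fg hJ0 hJfg
  have mem_one : ∀ a : K, a • J ≤ s.star J → a ∈ (1 : Submodule R K) := fun a ha =>
    hic J hJ0 hJfg ▸ s.mem_star_div_star hJ ha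
  obtain ⟨L, hL, hJL⟩ := hreg J hJ
  have hJJL : IsFrac R K (J * J * L) := (hJ.mul hJ).mul hL
  have hL_le : L ≤ 1 / J := Submodule.le_div_iff.2 fun l hl j hj => mem_one _ <| by
    rintro _ ⟨x, hx, rfl⟩
    rw [hJL]
    refine s.le_star _ hJJL ?_
    have : (x * j) * l ∈ J * J * L := Submodule.mul_mem_mul (Submodule.mul_mem_mul hx hj) hl
    convert this using 1
    simp only [DistribSMul.toLinearMap_apply, smul_eq_mul]
    ring
  obtain ⟨G, hG0, hGfg, hGle, hJG⟩ :=
    hft.exists_fg_le_star hJJL hJ0 hJfg (hJL ▸ s.le_star J hJ)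
  rw [mul_assoc] at hGle
  obtain ⟨F, hFfg, hFle, hGF⟩ := hGfg.exists_fg_le_mul hGle
  have hF0 : F ≠ ⊥ := by
    rintro rfl
    exact hG0 (le_bot_iff.1 (by simpa using hGF))
  have hG := isFrac_of_fg hG0 hGfg
  have h1F : 1 / F ≤ 1 := fun a ha => mem_one a <| by
    have haG : a • G ≤ s.star J := by
      rintro _ ⟨x, hx, rfl⟩
      have hx' := Submodule.mul_mem_mul ha (hGF hx)
      rw [mul_left_comm] at hx'
      refine s.le_star J hJ ?_
      have := mul_le_mul' (le_refl J)
        (Submodule.le_div_iff_mul_le.1 (le_refl (1 / F))) hx'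
      simpa using this
    exact le_trans (by
      rintro _ ⟨x, hx, rfl⟩
      exact Submodule.smul_mem_pointwise_smul x a _ (hJG hx)) (s.smul_star_le hG hJ haG)
  refine le_trans ?_ (le_iSup₂_of_le F
    ⟨hF0, hFfg, hFle.trans (mul_le_mul' le_rfl hL_le)⟩ le_rfl)
  exact Submodule.le_div_iff_mul_le.2 (by rwa [one_mul])
end
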